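/- Let H₁ and H₂ be complex Hilbert spaces, T > 0, and let j₀ ≥ 0 and k ≥ j₀ + 2 be integers. Let N : ℝ → B(H₁,H₂) be of class C^k in the operator norm with N(t) = 0 for t ≤ 0. Suppose N extends to a function Ñ, holomorphic on {t ∈ ℂ : Re t > T}, such that Ñ and its derivatives Ñ^{(j)} for 0 ≤ j ≤ k are continuous on {Re t ≥ T}, Ñ(t) = N(t) for real t ≥ T, and there are constants C_j with ‖Ñ^{(j)}(t)‖ ≤ C_j |t|^{j₀−j} for all Re t ≥ T and 0 ≤ j ≤ k. Then there exists a holomorphic function G : {λ ∈ ℂ : Im λ > 0} ∪ {λ ∈ ℂ : Re λ < 0} → B(H₁,H₂) such that G(λ) = ∫₀^∞ e^{iλt} N(t) dt for all λ with Im λ > 0, and for each 0 ≤ j ≤ k there is a constant C'_j such that ‖G(λ)‖ ≤ C'_j |λ|^{−j} e^{T|Im λ|} for all λ in the domain with |λ| > 1. -/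

import Mathlib

open MeasureTheory Set

open Filter Topology Asymptotics in
theorem aux_holo {E : Type*} [NormedAddCommGroup E] [NormedSpace ℂ E]
    (S : Set ℝ) (hS : MeasurableSet S) (γ : ℝ → ℂ) (hγ : Continuous γ) (f : ℝ → E)
    (hf : IntegrableOn f S) (z₀ : ℂ) (r c : ℝ) (hr : 0 < r)
    (hb : ∀ z ∈ Metric.ball z₀ r, ∀ t ∈ S, (Complex.I * z * γ t).re ≤ c) :
    DifferentiableAt ℂ (fun z : ℂ => ∫ t in S, Complex.exp (Complex.I * z * γ t) • f t) z₀ := by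
  have hmeas : ∀ z : ℂ, AEStronglyMeasurable
      (fun t => Complex.exp (Complex.I * z * γ t) • f t) (volume.restrict S) := fun z =>
    AEStronglyMeasurable.smul (by fun_prop) hf.aestronglyMeasurable
  have hexp : ∀ z ∈ Metric.ball z₀ r, ∀ t ∈ S,
      ‖Complex.exp (Complex.I * z * γ t)‖ ≤ Real.exp c := by
    intro z hz t ht
    rw [Complex.norm_exp]
    exact Real.exp_le_exp.2 (hb z hz t ht)
  have hder : ∀ (z : ℂ) (t : ℝ), HasDerivAt (fun z : ℂ => Complex.exp (Complex.I * z * γ t))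
      (Complex.exp (Complex.I * z * γ t) * (Complex.I * γ t)) z := by
    intro z t
    have h1 : HasDerivAt (fun z : ℂ => Complex.I * z * γ t) (Complex.I * γ t) z := by
      simpa using ((hasDerivAt_id z).const_mul Complex.I).mul_const (γ t)
    exact h1.cexp
  have := hasDerivAt_integral_of_dominated_loc_of_deriv_le (μ := volume.restrict S)
    (F := fun z t => Complex.exp (Complex.I * z * γ t) • f t)
    (F' := fun z t => (Complex.exp (Complex.I * z * γ t) * (Complex.I * γ t)) • f t)
    (x₀ := z₀) (s := Metric.ball z₀ (r / 2))
    (bound := fun t => Real.exp c / (r / 4) * ‖f t‖)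
    (Metric.ball_mem_nhds _ (by linarith)) (Eventually.of_forall hmeas)
    ?_ (AEStronglyMeasurable.smul (by fun_prop) hf.aestronglyMeasurable) ?_
    (hf.norm.const_mul _) ?_
  · exact this.2.differentiableAt
  · refine Integrable.mono' (hf.norm.const_mul (Real.exp c)) (hmeas z₀) ?_
    refine (ae_restrict_iff' hS).2 (Eventually.of_forall fun t ht => ?_)
    rw [norm_smul]
    gcongr
    exact hexp z₀ (Metric.mem_ball_self hr) t ht
  · refine (ae_restrict_iff' hS).2 (Eventually.of_forall fun t ht z hz => ?_)
    rw [norm_smul]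
    gcongr
    rw [← (hder z t).deriv]
    refine Complex.norm_deriv_le_of_forall_mem_sphere_norm_le (by linarith) ?_ ?_
    · exact Differentiable.diffContOnCl (fun z => (hder z t).differentiableAt)
    · intro y hy
      refine hexp y ?_ t ht
      rw [Metric.mem_ball] at *
      rw [Metric.mem_sphere] at hy
      linarith [dist_triangle y z z₀]
  · exact Eventually.of_forall fun t z _ => (hder z t).smul_const (f t)

open Filter Topology Asymptotics in
theorem aux_contour {E : Type*} [NormedAddCommGroup E] [NormedSpace ℂ E] [CompleteSpace E]
    (T K : ℝ) (hT : 0 < T) (h : ℂ → E)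
    (hc : ContinuousOn h {t : ℂ | T ≤ t.re})
    (hd : DifferentiableOn ℂ h {t : ℂ | T < t.re})
    (hK : ∀ t : ℂ, T ≤ t.re → t.im ≤ 0 → ∀ x : ℝ, |x| ≤ ‖t‖ → ‖h t‖ ≤ K * (1 + x ^ 2)⁻¹) :
    ∫ t in Ioi T, h (t : ℂ) = - (Complex.I • ∫ y in Iic (0 : ℝ), h (T + y * Complex.I)) := by
  have hi1 : IntegrableOn (fun t : ℝ => h (t : ℂ)) (Ioi T) := by
    refine Integrable.mono' (integrable_inv_one_add_sq.integrableOn.const_mul K) ?_ ?_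
    · refine ContinuousOn.aestronglyMeasurable ?_ measurableSet_Ioi
      refine hc.comp (by fun_prop) ?_
      intro t ht
      simpa using le_of_lt ht
    · refine (ae_restrict_iff' measurableSet_Ioi).2 (Eventually.of_forall fun t ht => ?_)
      exact hK _ (by simpa using le_of_lt ht) (by simp) _ (by simp)
  have hi2 : IntegrableOn (fun y : ℝ => h (T + y * Complex.I)) (Iic 0) := by
    refine Integrable.mono' (integrable_inv_one_add_sq.integrableOn.const_mul K) ?_ ?_
    · refine ContinuousOn.aestronglyMeasurable ?_ measurableSet_Iic
      refine hc.comp (by fun_prop) ?_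
      intro t ht
      simp
    · refine (ae_restrict_iff' measurableSet_Iic).2 (Eventually.of_forall fun t ht => ?_)
      refine hK _ (by simp) (by simpa using ht) _ ?_
      have := Complex.abs_im_le_norm ((T : ℂ) + t * Complex.I)
      simpa using this
  have l1 := intervalIntegral_tendsto_integral_Ioi T hi1 tendsto_id
  have l2 := intervalIntegral_tendsto_integral_Iic 0 hi2 tendsto_neg_atTop_atBot
  have hlim : Tendsto (fun R : ℝ => K * R⁻¹) atTop (𝓝 0) := by
    simpa using tendsto_inv_atTop_zero.const_mul K
  have hK0 : 0 ≤ K := by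
    have := hK T (by simp) (by simp) 0 (by simp)
    have := (norm_nonneg _).trans this
    simpa using this
  have key : ∀ R : ℝ, 0 < R → K * (1 + R ^ 2)⁻¹ * R ≤ K * R⁻¹ := by
    intro R hR
    rw [mul_assoc]
    gcongr
    rw [← div_eq_inv_mul, div_le_iff₀ (by positivity)]
    field_simp
    linarith
  have l3 : Tendsto (fun R : ℝ => ∫ x in T..R, h (x + ((-R : ℝ) : ℂ) * Complex.I)) atTop (𝓝 0) := by
    refine squeeze_zero_norm' ?_ hlim
    filter_upwards [eventually_gt_atTop T] with R hR
    have hR0 : 0 < R := hT.trans hR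
    refine le_trans (intervalIntegral.norm_integral_le_of_norm_le_const
      (C := K * (1 + R ^ 2)⁻¹) ?_) ?_
    · intro x hx
      rw [uIoc_of_le hR.le] at hx
      refine hK _ (by simpa using hx.1.le) (by simpa using hR0.le) _ ?_
      have := Complex.abs_im_le_norm ((x : ℂ) + ((-R : ℝ) : ℂ) * Complex.I)
      simpa using this
    · refine le_trans ?_ (key R hR0)
      gcongr
      rw [abs_of_pos (by linarith)]
      linarith
  have l4 : Tendsto (fun R : ℝ => ∫ y in (-R)..0, h (R + y * Complex.I)) atTop (𝓝 0) := by
    refine squeeze_zero_norm' ?_ hlim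
    filter_upwards [eventually_gt_atTop T] with R hR
    have hR0 : 0 < R := hT.trans hR
    refine le_trans (intervalIntegral.norm_integral_le_of_norm_le_const
      (C := K * (1 + R ^ 2)⁻¹) ?_) ?_
    · intro x hx
      rw [uIoc_of_le (by linarith)] at hx
      refine hK _ (by simpa using hR.le) (by simpa using hx.2) _ ?_
      have := Complex.abs_re_le_norm ((R : ℂ) + x * Complex.I)
      simpa using this
    · refine le_trans ?_ (key R hR0)
      gcongr
      rw [abs_of_pos (by linarith)]
      linarith
  have hcauchy : ∀ᶠ R : ℝ in atTop,
      (∫ x in T..R, h (x + ((-R : ℝ) : ℂ) * Complex.I)) - (∫ x in T..R, h (x : ℂ))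
      + Complex.I • (∫ y in (-R)..0, h (R + y * Complex.I))
      - Complex.I • (∫ y in (-R)..0, h (T + y * Complex.I)) = 0 := by
    filter_upwards [eventually_gt_atTop T] with R hR
    have := Complex.integral_boundary_rect_eq_zero_of_continuousOn_of_differentiableOn h
      (⟨T, -R⟩ : ℂ) (⟨R, 0⟩ : ℂ) ?_ ?_
    · simpa using this
    · refine hc.mono ?_
      intro t ht
      have := ht.1
      simp only [mem_preimage] at this
      rw [uIcc_of_le hR.le] at this
      exact this.1
    · refine hd.mono ?_
      intro t ht
      have := ht.1
      simp only [mem_preimage] at this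
      rw [min_eq_left hR.le] at this
      exact this.1
  have hfin := ((l3.sub l1).add (l4.const_smul Complex.I)).sub (l2.const_smul Complex.I)
  have h0 := tendsto_nhds_unique_of_eventuallyEq hfin tendsto_const_nhds hcauchy
  simp only [zero_sub, smul_zero, add_zero] at h0
  rw [sub_eq_zero] at h0
  rw [← h0, neg_neg]

open Filter Topology Asymptotics in
theorem aux_parts {E : Type*} [NormedAddCommGroup E] [NormedSpace ℂ E] [CompleteSpace E]
    (k m : ℕ) (N : ℝ → E) (hN : ContDiff ℝ (k : ℕ∞) N)
    (hNzero : ∀ t : ℝ, t ≤ 0 → N t = 0)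
    (hO : ∀ j, j ≤ k → (iteratedDeriv j N) =O[atTop] (fun t : ℝ => t ^ m))
    (z : ℂ) (hz : 0 < z.im) (j : ℕ) (hj : j ≤ k) :
    ∫ t in Ioi (0 : ℝ), Complex.exp (Complex.I * z * (t : ℂ)) • N t
      = (Complex.I / z) ^ j •
        ∫ t in Ioi (0 : ℝ), Complex.exp (Complex.I * z * (t : ℂ)) • iteratedDeriv j N t := by
  have hz0 : z ≠ 0 := by
    rintro rfl
    simp at hz
  have hcont : ∀ j, j ≤ k → Continuous (iteratedDeriv j N) := fun j hj =>
    hN.continuous_iteratedDeriv j (by exact_mod_cast hj)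
  have hOexp : ∀ j, j ≤ k → (fun t : ℝ => Complex.exp (Complex.I * z * (t : ℂ)) • iteratedDeriv j N t)
      =O[atTop] (fun t : ℝ => Real.exp (-(z.im / 2) * t)) := by
    intro j hj
    have h1 := (hO j hj).trans
      (isLittleO_pow_exp_pos_mul_atTop m (b := z.im / 2) (by linarith)).isBigO
    have h2 : (fun t : ℝ => Complex.exp (Complex.I * z * (t : ℂ))) =O[atTop]
        (fun t : ℝ => Real.exp (-z.im * t)) := by
      refine IsBigO.of_bound 1 (Eventually.of_forall fun t => ?_)
      rw [Complex.norm_exp]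
      simp
    refine (h2.smul h1).congr_right fun t => ?_
    rw [smul_eq_mul, ← Real.exp_add]
    congr 1
    ring
  have hint : ∀ j, j ≤ k → IntegrableOn
      (fun t : ℝ => Complex.exp (Complex.I * z * (t : ℂ)) • iteratedDeriv j N t) (Ioi 0) := by
    intro j hj
    have hc : Continuous
        (fun t : ℝ => Complex.exp (Complex.I * z * (t : ℂ)) • iteratedDeriv j N t) :=
      (by fun_prop : Continuous (fun t : ℝ => Complex.exp (Complex.I * z * (t : ℂ)))).smul
        (hcont j hj)
    refine (integrable_norm_iff hc.aestronglyMeasurable).1 ?_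
    exact integrable_of_isBigO_exp_neg (by linarith : 0 < z.im / 2) hc.norm.continuousOn
      (hOexp j hj).norm_left
  have hlim : ∀ j, j ≤ k → Tendsto
      (fun t : ℝ => Complex.exp (Complex.I * z * (t : ℂ)) • iteratedDeriv j N t) atTop (𝓝 0) := by
    intro j hj
    refine (hOexp j hj).trans_tendsto ?_
    refine Real.tendsto_exp_atBot.comp ?_
    exact tendsto_id.const_mul_atTop_of_neg (by linarith)
  have hzero : ∀ j, j ≤ k → iteratedDeriv j N 0 = 0 := by
    intro j hj
    have hneg : ∀ t ∈ Iio (0 : ℝ), iteratedDeriv j N t = 0 := by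
      intro t ht
      have : N =ᶠ[𝓝 t] fun _ => (0 : E) := by
        filter_upwards [Iio_mem_nhds ht] with s hs
        exact hNzero s (le_of_lt hs)
      rw [this.iteratedDeriv_eq j]
      simp
    have h1 : Tendsto (iteratedDeriv j N) (𝓝[<] 0) (𝓝 (iteratedDeriv j N 0)) :=
      ((hcont j hj).tendsto 0).mono_left nhdsWithin_le_nhds
    have h2 : Tendsto (iteratedDeriv j N) (𝓝[<] 0) (𝓝 0) :=
      tendsto_const_nhds.congr' (by
        filter_upwards [self_mem_nhdsWithin] with t ht
        exact (hneg t ht).symm)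
    exact tendsto_nhds_unique h1 h2
  induction j with
  | zero => simp
  | succ j ih =>
    rw [ih (by omega)]
    have hd : ∀ t : ℝ, HasDerivAt
        (fun t : ℝ => Complex.exp (Complex.I * z * (t : ℂ)) • iteratedDeriv j N t)
        (Complex.exp (Complex.I * z * (t : ℂ)) • iteratedDeriv (j + 1) N t
          + (Complex.I * z) • Complex.exp (Complex.I * z * (t : ℂ)) • iteratedDeriv j N t) t := by
      intro t
      have h1 : HasDerivAt (fun t : ℝ => Complex.exp (Complex.I * z * (t : ℂ)))
          (Complex.exp (Complex.I * z * (t : ℂ)) * (Complex.I * z)) t := by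
        have h0 : HasDerivAt (fun t : ℂ => Complex.I * z * t) (Complex.I * z) (t : ℂ) := by
          simpa using (hasDerivAt_id (t : ℂ)).const_mul (Complex.I * z)
        exact h0.cexp.comp_ofReal
      have h2 : HasDerivAt (iteratedDeriv j N) (iteratedDeriv (j + 1) N t) t := by
        rw [iteratedDeriv_succ]
        exact ((hN.differentiable_iteratedDeriv j (by exact_mod_cast hj)) t).hasDerivAt
      have := h1.smul h2
      rw [smul_smul, mul_comm (Complex.I * z) (Complex.exp _)]
      exact this
    have hI := integral_Ioi_of_hasDerivAt_of_tendsto' (a := 0) (fun t _ => hd t)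
      ((hint (j + 1) hj).add ((hint j (by omega)).smul (Complex.I * z))) (hlim j (by omega))
    rw [hzero j (by omega)] at hI
    have hA := integral_add (hint (j + 1) hj) ((hint j (by omega)).smul (Complex.I * z))
    have hB := integral_smul (μ := volume.restrict (Ioi (0 : ℝ))) (Complex.I * z)
      (fun t : ℝ => Complex.exp (Complex.I * z * (t : ℂ)) • iteratedDeriv j N t)
    simp only [Pi.smul_apply, smul_zero, sub_zero] at hI hA
    rw [hA, hB] at hI
    rw [eq_neg_of_add_eq_zero_left hI, pow_succ, ← smul_smul, smul_neg, smul_smul, ← neg_smul]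
    have : -(Complex.I / z * (Complex.I * z)) = 1 := by
      field_simp
      simp
    rw [this, one_smul]

open Filter Topology Asymptotics in
theorem aux_bound {E : Type*} [NormedAddCommGroup E] [NormedSpace ℂ E]
    (S : Set ℝ) (hS : MeasurableSet S) (γ : ℝ → ℂ) (hγ : Continuous γ) (f : ℝ → E)
    (hf : IntegrableOn f S) (z : ℂ) (c : ℝ)
    (hb : ∀ t ∈ S, (Complex.I * z * γ t).re ≤ c) :
    IntegrableOn (fun t => Complex.exp (Complex.I * z * γ t) • f t) S ∧
    ‖∫ t in S, Complex.exp (Complex.I * z * γ t) • f t‖ ≤ (∫ t in S, ‖f t‖) * Real.exp c := by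
  have hle : ∀ᵐ t ∂(volume.restrict S),
      ‖Complex.exp (Complex.I * z * γ t) • f t‖ ≤ ‖f t‖ * Real.exp c := by
    refine (ae_restrict_iff' hS).2 (Eventually.of_forall fun t ht => ?_)
    rw [norm_smul, mul_comm, Complex.norm_exp]
    gcongr
    exact hb t ht
  refine ⟨Integrable.mono' (hf.norm.mul_const _)
    (AEStronglyMeasurable.smul (by fun_prop) hf.aestronglyMeasurable) hle, ?_⟩
  rw [← integral_mul_const]
  exact norm_integral_le_of_norm_le (hf.norm.mul_const _) hle

open Filter Topology Asymptotics in
theorem aux_main {E : Type*} [NormedAddCommGroup E] [NormedSpace ℂ E] [CompleteSpace E]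
    (T : ℝ) (hT : 0 < T) (j₀ k : ℕ) (hk : j₀ + 2 ≤ k)
    (N : ℝ → E) (hN : ContDiff ℝ (k : ℕ∞) N)
    (hNzero : ∀ t : ℝ, t ≤ 0 → N t = 0)
    (Nt : ℂ → E)
    (hNtHol : DifferentiableOn ℂ Nt {t : ℂ | T < t.re})
    (hNtContDeriv : ∀ j, j ≤ k → ContinuousOn (iteratedDeriv j Nt) {t : ℂ | T ≤ t.re})
    (hAgree : ∀ t : ℝ, T ≤ t → Nt (t : ℂ) = N t)
    (Cj : ℕ → ℝ)
    (hNtBound : ∀ j, j ≤ k → ∀ t : ℂ, T ≤ t.re →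
      ‖iteratedDeriv j Nt t‖ ≤ Cj j * ‖t‖ ^ ((j₀ : ℤ) - (j : ℤ))) :
    ∃ G : ℂ → E,
      DifferentiableOn ℂ G ({z : ℂ | 0 < z.im} ∪ {z : ℂ | z.re < 0}) ∧
      (∀ z : ℂ, 0 < z.im →
        G z = ∫ t in Ioi (0 : ℝ), Complex.exp (Complex.I * z * (t : ℂ)) • N t) ∧
      ∀ j, j ≤ k → ∃ C' : ℝ, 0 < C' ∧
        ∀ z ∈ ({z : ℂ | 0 < z.im} ∪ {z : ℂ | z.re < 0}), 1 < ‖z‖ →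
          ‖G z‖ ≤ C' * ‖z‖ ^ (-(j : ℤ)) * Real.exp (T * |z.im|) := by
  have hopen : IsOpen {t : ℂ | T < t.re} := isOpen_lt continuous_const Complex.continuous_re
  have hdiff : ∀ j, DifferentiableOn ℂ (iteratedDeriv j Nt) {t : ℂ | T < t.re} := by
    intro j
    have := (hNtHol.analyticOnNhd hopen).iterated_deriv j
    rw [iteratedDeriv_eq_iterate]
    exact this.differentiableOn
  have hagree : ∀ j, ∀ t : ℝ, T < t → iteratedDeriv j N t = iteratedDeriv j Nt (t : ℂ) := by
    intro j
    induction j with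
    | zero =>
      intro t ht
      simpa using (hAgree t ht.le).symm
    | succ j ih =>
      intro t ht
      rw [iteratedDeriv_succ, iteratedDeriv_succ]
      have h1 : HasDerivAt (fun s : ℝ => iteratedDeriv j Nt (s : ℂ))
          (deriv (iteratedDeriv j Nt) (t : ℂ)) t := by
        have h0 := ((hdiff j).differentiableAt
          (hopen.mem_nhds (by simpa using ht) : {t : ℂ | T < t.re} ∈ 𝓝 (t : ℂ))).hasDerivAt
        simpa using! h0.scomp t Complex.ofRealCLM.hasDerivAt
      refine (h1.congr_of_eventuallyEq ?_).deriv
      filter_upwards [Ioi_mem_nhds ht] with s hs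
      exact ih s hs
  have hO : ∀ j, j ≤ k → (iteratedDeriv j N) =O[atTop] (fun t : ℝ => t ^ j₀) := by
    intro j hj
    refine IsBigO.of_bound (|Cj j| * (T ^ j)⁻¹) ?_
    filter_upwards [eventually_gt_atTop T] with t ht
    have ht0 : 0 < t := hT.trans ht
    rw [hagree j t ht]
    refine (hNtBound j hj t (by simpa using ht.le)).trans ?_
    have e1 : ‖(t : ℂ)‖ = t := by simp [abs_of_pos ht0]
    rw [e1, zpow_sub₀ ht0.ne', zpow_natCast, zpow_natCast, norm_pow, Real.norm_of_nonneg ht0.le,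
      div_eq_inv_mul, ← mul_assoc]
    gcongr
    exact le_abs_self _
  obtain ⟨K, hK⟩ : ∃ K : ℝ, ∀ t : ℂ, T ≤ t.re → ∀ x : ℝ, |x| ≤ ‖t‖ →
      ‖iteratedDeriv k Nt t‖ ≤ K * (1 + x ^ 2)⁻¹ := by
    obtain ⟨d, rfl⟩ := Nat.exists_eq_add_of_le hk
    refine ⟨|Cj (j₀ + 2 + d)| * (T ^ d)⁻¹ * (1 + (T ^ 2)⁻¹), fun t ht x hx => ?_⟩
    have htn : T ≤ ‖t‖ := ht.trans (Complex.re_le_norm t)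
    have ht0 : 0 < ‖t‖ := hT.trans_le htn
    refine (hNtBound _ le_rfl t ht).trans ?_
    have e : (j₀ : ℤ) - ((j₀ + 2 + d : ℕ) : ℤ) = -((d + 2 : ℕ) : ℤ) := by push_cast; ring
    rw [e, zpow_neg, zpow_natCast, pow_add, mul_inv, ← mul_assoc, mul_assoc _ (1 + (T ^ 2)⁻¹) _]
    have hx2 : x ^ 2 ≤ ‖t‖ ^ 2 := by
      rw [← sq_abs x]
      gcongr
    have hT2 : 1 ≤ (T ^ 2)⁻¹ * ‖t‖ ^ 2 := by
      rw [← div_eq_inv_mul, one_le_div (by positivity)]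
      gcongr
    have h3 : (‖t‖ ^ 2)⁻¹ ≤ (1 + (T ^ 2)⁻¹) * (1 + x ^ 2)⁻¹ := by
      rw [← div_eq_mul_inv, le_div_iff₀ (by positivity), ← div_eq_inv_mul,
        div_le_iff₀ (by positivity)]
      linarith
    gcongr
    exact le_abs_self _
  set M := iteratedDeriv k N with hM
  set P := iteratedDeriv k Nt with hP
  have hMc : Continuous M := hN.continuous_iteratedDeriv k le_rfl
  have iF : IntegrableOn M (Ioc 0 T) := hMc.integrableOn_Ioc
  have iA : IntegrableOn M (Ioi T) := by
    refine Integrable.mono' (integrable_inv_one_add_sq.integrableOn.const_mul K)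
      hMc.aestronglyMeasurable ?_
    refine (ae_restrict_iff' measurableSet_Ioi).2 (Eventually.of_forall fun t ht => ?_)
    rw [hM, hagree k t ht]
    exact hK _ (by simpa using le_of_lt ht) _ (by simp)
  have iB : IntegrableOn (fun y : ℝ => P (T + y * Complex.I)) (Iic 0) := by
    refine Integrable.mono' (integrable_inv_one_add_sq.integrableOn.const_mul K) ?_ ?_
    · refine ContinuousOn.aestronglyMeasurable ?_ measurableSet_Iic
      refine (hNtContDeriv k le_rfl).comp (by fun_prop) ?_
      intro t ht
      simp
    · refine (ae_restrict_iff' measurableSet_Iic).2 (Eventually.of_forall fun t ht => ?_)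
      refine hK _ (by simp) _ ?_
      have := Complex.abs_im_le_norm ((T : ℂ) + t * Complex.I)
      simpa using this
  set F : ℂ → E := fun z => ∫ t in Ioc 0 T, Complex.exp (Complex.I * z * (t : ℂ)) • M t with hF
  set A : ℂ → E := fun z => ∫ t in Ioi T, Complex.exp (Complex.I * z * (t : ℂ)) • M t with hA
  set B : ℂ → E := fun z => -(Complex.I • ∫ y in Iic (0 : ℝ),
    Complex.exp (Complex.I * z * (T + y * Complex.I)) • P (T + y * Complex.I)) with hB
  -- real parts of the phases
  have reR : ∀ (z : ℂ) (t : ℝ), (Complex.I * z * (t : ℂ)).re = -(z.im * t) := by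
    intro z t
    simp
  have reB : ∀ (z : ℂ) (y : ℝ), (Complex.I * z * (T + y * Complex.I)).re
      = -(z.im * T) - z.re * y := by
    intro z y
    simp
  have neg_im : ∀ (z : ℂ) (t : ℝ), 0 ≤ t → t ≤ T → -(z.im * t) ≤ T * |z.im| := by
    intro z t h0 h1
    have := neg_abs_le z.im
    have h2 := abs_nonneg z.im
    nlinarith
  have dF : ∀ z, DifferentiableAt ℂ F z := by
    intro z
    refine aux_holo (Ioc 0 T) measurableSet_Ioc (fun t => (t : ℂ)) (by fun_prop) M iF z 1
      (T * (‖z‖ + 1)) one_pos ?_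
    intro w hw t ht
    rw [reR]
    refine (neg_im w t ht.1.le ht.2).trans ?_
    gcongr
    refine (Complex.abs_im_le_norm w).trans ?_
    rw [Metric.mem_ball, dist_eq_norm] at hw
    have := norm_add_le z (w - z)
    rw [add_sub_cancel] at this
    linarith
  have dA : ∀ z : ℂ, 0 < z.im → DifferentiableAt ℂ A z := by
    intro z hz
    obtain ⟨r, hr, hball⟩ := Metric.isOpen_iff.1
      (isOpen_lt continuous_const Complex.continuous_im : IsOpen {z : ℂ | 0 < z.im}) z hz
    refine aux_holo (Ioi T) measurableSet_Ioi (fun t => (t : ℂ)) (by fun_prop) M iA z r 0 hr ?_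
    intro w hw t ht
    have hw' : 0 < w.im := hball hw
    have ht' : 0 < t := hT.trans ht
    rw [reR]
    nlinarith
  have dB : ∀ z : ℂ, z.re < 0 → DifferentiableAt ℂ B z := by
    intro z hz
    obtain ⟨r, hr, hball⟩ := Metric.isOpen_iff.1
      (isOpen_lt Complex.continuous_re continuous_const : IsOpen {z : ℂ | z.re < 0}) z hz
    refine ((aux_holo (Iic 0) measurableSet_Iic (fun y : ℝ => (T : ℂ) + y * Complex.I)
      (by fun_prop) _ iB z (min r 1) (T * (‖z‖ + 1)) (by positivity) ?_).const_smul Complex.I).neg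
    intro w hw t ht
    have hw' : w.re < 0 := hball (Metric.ball_subset_ball (min_le_left _ _) hw)
    have ht' : t ≤ 0 := ht
    rw [reB]
    have h1 := neg_im w T hT.le le_rfl
    have h2 : 0 ≤ w.re * t := mul_nonneg_of_nonpos_of_nonpos hw'.le ht'
    have h3 : T * |w.im| ≤ T * (‖z‖ + 1) := by
      gcongr
      refine (Complex.abs_im_le_norm w).trans ?_
      have hw2 := Metric.ball_subset_ball (min_le_right r 1) hw
      rw [Metric.mem_ball, dist_eq_norm] at hw2
      have := norm_add_le z (w - z)
      rw [add_sub_cancel] at this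
      linarith
    linarith
  have bF : ∀ z : ℂ, IntegrableOn (fun t : ℝ => Complex.exp (Complex.I * z * (t : ℂ)) • M t)
      (Ioc 0 T) ∧ ‖F z‖ ≤ (∫ t in Ioc 0 T, ‖M t‖) * Real.exp (T * |z.im|) := fun z =>
    aux_bound (Ioc 0 T) measurableSet_Ioc (fun t => (t : ℂ)) (by fun_prop) M iF z _
      (fun t ht => (reR z t).trans_le (neg_im z t ht.1.le ht.2))
  have bA : ∀ z : ℂ, 0 < z.im →
      IntegrableOn (fun t : ℝ => Complex.exp (Complex.I * z * (t : ℂ)) • M t) (Ioi T) ∧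
      ‖A z‖ ≤ (∫ t in Ioi T, ‖M t‖) * Real.exp (T * |z.im|) := fun z hz =>
    aux_bound (Ioi T) measurableSet_Ioi (fun t => (t : ℂ)) (by fun_prop) M iA z _
      (fun t ht => by
        have ht' : 0 < t := hT.trans ht
        have h1 : 0 ≤ T * |z.im| := by positivity
        rw [reR]
        nlinarith [mul_pos hz ht'])
  have bB : ∀ z : ℂ, z.re < 0 →
      ‖B z‖ ≤ (∫ y in Iic (0 : ℝ), ‖P (T + y * Complex.I)‖) * Real.exp (T * |z.im|) := by
    intro z hz
    rw [hB]
    simp only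
    rw [norm_neg, norm_smul, Complex.norm_I, one_mul]
    refine (aux_bound (Iic 0) measurableSet_Iic (fun y : ℝ => (T : ℂ) + y * Complex.I)
      (by fun_prop) _ iB z _ (fun y hy => ?_)).2
    rw [reB]
    have hy' : y ≤ 0 := hy
    linarith [neg_im z T hT.le le_rfl, mul_nonneg_of_nonpos_of_nonpos hz.le hy']
  have hAB : ∀ z : ℂ, 0 < z.im → z.re < 0 → A z = B z := by
    intro z hz1 hz2
    have := aux_contour T K hT (fun t => Complex.exp (Complex.I * z * t) • P t) ?_ ?_ ?_
    · rw [hB]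
      simp only
      rw [← this, hA]
      refine setIntegral_congr_fun measurableSet_Ioi fun t ht => ?_
      rw [hM, hagree k t ht]
    · exact ContinuousOn.smul (by fun_prop) (hNtContDeriv k le_rfl)
    · exact DifferentiableOn.smul (by fun_prop) (hdiff k)
    · intro t ht1 ht2 x hx
      rw [norm_smul, Complex.norm_exp]
      refine (mul_le_of_le_one_left (norm_nonneg _) ?_).trans (hK t ht1 x hx)
      rw [Real.exp_le_one_iff]
      simp only [Complex.mul_re, Complex.mul_im, Complex.I_re, Complex.I_im]
      nlinarith [mul_nonneg_of_nonpos_of_nonpos hz2.le ht2, mul_pos hz1 (hT.trans_le ht1)]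
  classical
  set G : ℂ → E := fun z => (Complex.I / z) ^ k • (F z + if 0 < z.im then A z else B z) with hG
  have dom0 : ∀ z ∈ ({z : ℂ | 0 < z.im} ∪ {z : ℂ | z.re < 0}), z ≠ 0 := by
    rintro z hz rfl
    simp at hz
  refine ⟨G, ?_, ?_, ?_⟩
  · intro z hz
    refine DifferentiableAt.differentiableWithinAt ?_
    have hz0 := dom0 z hz
    have dpow : DifferentiableAt ℂ (fun z : ℂ => (Complex.I / z) ^ k) z :=
      ((differentiableAt_const _).div differentiableAt_id hz0).pow k
    rcases hz with hz | hz
    · refine (dpow.smul ((dF z).add (dA z hz))).congr_of_eventuallyEq ?_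
      filter_upwards [(isOpen_lt continuous_const Complex.continuous_im :
        IsOpen {z : ℂ | 0 < z.im}).mem_nhds hz] with w hw
      have hw' : 0 < w.im := hw
      simp [hG, hw']
    · refine (dpow.smul ((dF z).add (dB z hz))).congr_of_eventuallyEq ?_
      filter_upwards [(isOpen_lt Complex.continuous_re continuous_const :
        IsOpen {z : ℂ | z.re < 0}).mem_nhds hz] with w hw
      by_cases hw' : 0 < w.im
      · simp [hG, hw', hAB w hw' hw]
      · simp [hG, hw']
  · intro z hz
    rw [aux_parts k j₀ N hN hNzero hO z hz k le_rfl]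
    simp only [hG, hz, if_true]
    congr 1
    rw [← Ioc_union_Ioi_eq_Ioi hT.le, setIntegral_union (Ioc_disjoint_Ioi le_rfl) measurableSet_Ioi]
    · exact (bF z).1
    · exact (bA z hz).1
  · intro j hj
    set cF := ∫ t in Ioc 0 T, ‖M t‖ with hcF
    set cA := ∫ t in Ioi T, ‖M t‖ with hcA
    set cB := ∫ y in Iic (0 : ℝ), ‖P (T + y * Complex.I)‖ with hcB
    have pF : 0 ≤ cF := integral_nonneg fun _ => norm_nonneg _
    have pA : 0 ≤ cA := integral_nonneg fun _ => norm_nonneg _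
    have pB : 0 ≤ cB := integral_nonneg fun _ => norm_nonneg _
    refine ⟨cF + cA + cB + 1, by positivity, fun z hz hz1 => ?_⟩
    have hz0 : 0 < ‖z‖ := by linarith
    have hsum : ‖F z + if 0 < z.im then A z else B z‖
        ≤ (cF + cA + cB + 1) * Real.exp (T * |z.im|) := by
      refine (norm_add_le _ _).trans ?_
      have h1 := (bF z).2
      have he := Real.exp_pos (T * |z.im|)
      have h2 : ‖if 0 < z.im then A z else B z‖ ≤ (cA + cB) * Real.exp (T * |z.im|) := by
        split_ifs with him
        · refine ((bA z him).2).trans ?_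
          gcongr
          linarith
        · have hre : z.re < 0 := hz.resolve_left him
          refine (bB z hre).trans ?_
          gcongr
          linarith
      have h1' : ‖F z‖ ≤ cF * Real.exp (T * |z.im|) := h1
      linarith
    have hpow : ‖(Complex.I / z) ^ k‖ ≤ ‖z‖ ^ (-(j : ℤ)) := by
      rw [norm_pow, norm_div, Complex.norm_I, one_div, inv_pow, zpow_neg, zpow_natCast]
      gcongr
      exact hz1.le
    calc ‖G z‖ = ‖(Complex.I / z) ^ k‖ * ‖F z + if 0 < z.im then A z else B z‖ := norm_smul _ _
      _ ≤ ‖z‖ ^ (-(j : ℤ)) * ((cF + cA + cB + 1) * Real.exp (T * |z.im|)) := by gcongr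
      _ = _ := by ring

/-- Left-hand branch of the Fourier transform lemma (Lemma 2.1): a causally
supported `C^k` operator family which is analytic past time `T` with derivative bounds
`‖Ñ^{(j)}(t)‖ ≤ C_j |t|^{j₀−j}` has a Fourier–Laplace transform continuing holomorphically
to `{Im λ > 0} ∪ {Re λ < 0}` with bounds `C'_j |λ|^{−j} e^{T|Im λ|}` for `|λ| > 1`. -/
theorem fourier_transform_lemma_left_branch
    {H₁ H₂ : Type*} [NormedAddCommGroup H₁] [InnerProductSpace ℂ H₁] [CompleteSpace H₁]
    [NormedAddCommGroup H₂] [InnerProductSpace ℂ H₂] [CompleteSpace H₂]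
    (T : ℝ) (hT : 0 < T) (j₀ k : ℕ) (hk : j₀ + 2 ≤ k)
    (N : ℝ → (H₁ →L[ℂ] H₂)) (hN : ContDiff ℝ (k : ℕ∞) N)
    (hNzero : ∀ t : ℝ, t ≤ 0 → N t = 0)
    (Nt : ℂ → (H₁ →L[ℂ] H₂))
    (hNtHol : DifferentiableOn ℂ Nt {t : ℂ | T < t.re})
    (hNtContDeriv : ∀ j, j ≤ k → ContinuousOn (iteratedDeriv j Nt) {t : ℂ | T ≤ t.re})
    (hAgree : ∀ t : ℝ, T ≤ t → Nt (t : ℂ) = N t)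
    (Cj : ℕ → ℝ)
    (hNtBound : ∀ j, j ≤ k → ∀ t : ℂ, T ≤ t.re →
      ‖iteratedDeriv j Nt t‖ ≤ Cj j * ‖t‖ ^ ((j₀ : ℤ) - (j : ℤ))) :
    ∃ G : ℂ → (H₁ →L[ℂ] H₂),
      DifferentiableOn ℂ G ({z : ℂ | 0 < z.im} ∪ {z : ℂ | z.re < 0}) ∧
      (∀ z : ℂ, 0 < z.im →
        G z = ∫ t in Ioi (0 : ℝ), Complex.exp (Complex.I * z * (t : ℂ)) • N t) ∧
      ∀ j, j ≤ k → ∃ C' : ℝ, 0 < C' ∧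
        ∀ z ∈ ({z : ℂ | 0 < z.im} ∪ {z : ℂ | z.re < 0}), 1 < ‖z‖ →
          ‖G z‖ ≤ C' * ‖z‖ ^ (-(j : ℤ)) * Real.exp (T * |z.im|) := by
  exact aux_main T hT j₀ k hk N hN hNzero Nt hNtHol hNtContDeriv hAgree Cj hNtBound
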